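/- arXiv:1108.1818 — 3 statements merged into one kernel-verified Lean document; each statement's English description precedes it below -/
import Mathlib

section
/- Let I be a tall P-ideal on ℕ containing all singletons, let (U_n)_{n∈ℕ} be a sequence of pairwise disjoint subsets of ℕ, let (u_n)_{n∈ℕ} be a sequence of I-ultrafilters on ℕ with U_n ∈ u_n for every n, and let v be an I-ultrafilter on ℕ. Then the contour ∫_v {u_n : n ∈ ℕ} is an I-ultrafilter on ℕ. -/
open Filter Set

/-- An ideal on ℕ: a nonempty collection closed under subsets and finite unions. -/
def IsIdeal (I : Set (Set ℕ)) : Prop :=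
  I.Nonempty ∧ (∀ A B : Set ℕ, A ⊆ B → B ∈ I → A ∈ I) ∧
    (∀ A ∈ I, ∀ B ∈ I, A ∪ B ∈ I)

/-- A tall ideal: every infinite set has an infinite subset in the ideal. -/
def IsTall (I : Set (Set ℕ)) : Prop :=
  ∀ A : Set ℕ, A.Infinite → ∃ B ∈ I, B ⊆ A ∧ B.Infinite

/-- A P-ideal: every countable family in the ideal has a pseudo-union in the ideal. -/
def IsPIdeal (I : Set (Set ℕ)) : Prop :=
  ∀ s : ℕ → Set ℕ, (∀ n, s n ∈ I) → ∃ J ∈ I, ∀ n, (s n \ J).Finite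

/-- The ideal contains all singletons. -/
def ContainsSingletons (I : Set (Set ℕ)) : Prop :=
  ∀ k : ℕ, ({k} : Set ℕ) ∈ I

/-- An I-ultrafilter: for every f : ℕ → ℕ some member of u has image in I. -/
def IsIUltrafilter (I : Set (Set ℕ)) (u : Ultrafilter ℕ) : Prop :=
  ∀ f : ℕ → ℕ, ∃ U ∈ u, f '' U ∈ I

/-- A free ultrafilter: one containing the Fréchet (cofinite) filter. -/
def IsFree (u : Ultrafilter ℕ) : Prop :=
  Filter.cofinite ≤ (u : Filter ℕ)

/-- A P-point: a free ultrafilter such that every countable family of its members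
has a pseudo-intersection in the ultrafilter. -/
def IsPPoint (u : Ultrafilter ℕ) : Prop :=
  IsFree u ∧ ∀ s : ℕ → Set ℕ, (∀ n, s n ∈ u) → ∃ U ∈ u, ∀ n, (U \ s n).Finite

/-- The contour ∫_v {u_n : n ∈ ℕ}: the ultrafilter whose members are the sets A
with {n | A ∈ u n} ∈ v (the bind of v and (u_n)). -/
def contour (v : Ultrafilter ℕ) (u : ℕ → Ultrafilter ℕ) : Ultrafilter ℕ :=
  v.bind u

/-- The rank-2 contour of a sequence of pairwise disjoint infinite sets:
the collection of sets U such that for all but finitely many n, A n \ U is finite. -/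
def rank2Contour (A : ℕ → Set ℕ) : Set (Set ℕ) :=
  {U : Set ℕ | ∀ᶠ n in Filter.cofinite, (A n \ U).Finite}

/-- The rank-3 contour of a doubly indexed family of pairwise disjoint infinite sets. -/
def rank3Contour (A : ℕ → ℕ → Set ℕ) : Set (Set ℕ) :=
  {U : Set ℕ | ∀ᶠ n in Filter.cofinite, ∀ᶠ m in Filter.cofinite, (A n m \ U).Finite}

/-- The finite intersection property. -/
def HasFIP (𝒜 : Set (Set ℕ)) : Prop :=
  ∀ G : Finset (Set ℕ), ↑G ⊆ 𝒜 → (⋂₀ (G : Set (Set ℕ))).Nonempty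

/-- the contour of I-ultrafilters along an I-ultrafilter,
with respect to pairwise disjoint witnessing sets, is an I-ultrafilter. -/
theorem contour_isIUltrafilter
    (I : Set (Set ℕ)) (hI : IsIdeal I) (hTall : IsTall I) (hPid : IsPIdeal I)
    (hSing : ContainsSingletons I)
    (U : ℕ → Set ℕ) (hUdisj : ∀ m n : ℕ, m ≠ n → Disjoint (U m) (U n))
    (u : ℕ → Ultrafilter ℕ) (hu : ∀ n, IsIUltrafilter I (u n))
    (hUu : ∀ n, U n ∈ u n)
    (v : Ultrafilter ℕ) (hv : IsIUltrafilter I v) :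
    IsIUltrafilter I (contour v u) := by
  classical
  obtain ⟨-, hsub, -⟩ := hI
  intro f
  choose A hA hAI using fun n => hu n f
  obtain ⟨J, hJ, hfin⟩ := hPid (fun n => f '' A n) hAI
  by_cases hP : {n | ∃ k, f ⁻¹' {k} ∈ u n} ∈ v
  · let g : ℕ → ℕ := fun n => if h : ∃ k, f ⁻¹' {k} ∈ u n then h.choose else 0
    obtain ⟨V, hV, hgV⟩ := hv g
    refine ⟨f ⁻¹' (g '' V), ?_, hsub _ _ (Set.image_preimage_subset _ _) hgV⟩
    change {n | f ⁻¹' (g '' V) ∈ u n} ∈ (v : Filter ℕ)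
    filter_upwards [hP, hV] with n hn hnV
    have h1 : f ⁻¹' {g n} ∈ u n := by
      simp only [g]
      rw [dif_pos hn]
      exact hn.choose_spec
    refine Filter.mem_of_superset h1 (Set.preimage_mono ?_)
    rintro _ rfl
    exact ⟨n, hnV, rfl⟩
  · refine ⟨f ⁻¹' J, ?_, hsub _ _ (Set.image_preimage_subset _ _) hJ⟩
    change {n | f ⁻¹' J ∈ u n} ∈ (v : Filter ℕ)
    have hP2 := Ultrafilter.compl_mem_iff_notMem.2 hP
    filter_upwards [hP2] with n hn
    by_contra hJn
    apply hn
    have hc : (f ⁻¹' J)ᶜ ∈ u n := Ultrafilter.compl_mem_iff_notMem.2 hJn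
    have hd : f '' A n \ J ∈ (u n).map f := by
      change f ⁻¹' (f '' A n \ J) ∈ (u n : Filter ℕ)
      filter_upwards [hA n, hc] with x hx hx2
      exact ⟨⟨x, hx, rfl⟩, hx2⟩
    obtain ⟨k, -, hk⟩ := Ultrafilter.eq_pure_of_finite_mem (hfin n) hd
    refine ⟨k, ?_⟩
    have : ({k} : Set ℕ) ∈ (u n).map f := by
      rw [hk]; exact Set.mem_singleton k
    exact this
end

section
/- Let I be a tall ideal on ℕ containing all singletons, let (F_n)_{n∈ℕ} be a strictly decreasing sequence of subsets of ℕ (i.e., F_{n+1} ⊊ F_n for every n), and let f : ℕ → ℕ. Then there exists a set G ⊆ ℕ such that f '' G ∈ I and G ∩ F_n is infinite for every n; in particular the family {F_n : n ∈ ℕ} ∪ {G} has the finite intersection property. -/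
open Filter Set

/-- given a tall ideal containing singletons, a strictly decreasing
sequence of sets and a function f, there is a set G with f '' G ∈ I meshing the
sequence; in particular {F n} ∪ {G} has the finite intersection property. -/
theorem exists_meshing_set_image_in_ideal
    (I : Set (Set ℕ)) (hI : IsIdeal I) (hTall : IsTall I)
    (hSing : ContainsSingletons I)
    (F : ℕ → Set ℕ) (hF : ∀ n, F (n + 1) ⊂ F n) (f : ℕ → ℕ) :
    ∃ G : Set ℕ, f '' G ∈ I ∧ (∀ n, (G ∩ F n).Infinite) ∧
      HasFIP (Set.range F ∪ {G}) := by
  have hx : ∀ n, ∃ a, a ∈ F n ∧ a ∉ F (n + 1) := fun n => Set.exists_of_ssubset (hF n)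
  choose x hx1 hx2 using hx
  have hanti : Antitone F := antitone_nat_of_succ_le fun n => (hF n).subset
  have hinj : Function.Injective x := by
    intro a b hab
    by_contra hne
    rcases Nat.lt_or_gt_of_ne hne with h | h
    · exact hx2 a (hanti (Nat.succ_le_of_lt h) (hab ▸ hx1 b))
    · exact hx2 b (hanti (Nat.succ_le_of_lt h) (hab ▸ hx1 a))
  have hB : ∃ B ∈ I, {n | f (x n) ∈ B}.Infinite := by
    by_cases hr : (Set.range fun n => f (x n)).Infinite
    · obtain ⟨B, hBI, hBs, hBinf⟩ := hTall _ hr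
      refine ⟨B, hBI, fun hfin => hBinf ((hfin.image fun n => f (x n)).subset ?_)⟩
      intro b hb
      obtain ⟨n, rfl⟩ := hBs hb
      exact ⟨n, hb, rfl⟩
    · rw [Set.not_infinite] at hr
      by_contra hcon
      push Not at hcon
      have h2 : (⋃ k ∈ Set.range fun n => f (x n), {n | f (x n) ∈ ({k} : Set ℕ)}).Finite :=
        hr.biUnion fun k _ => by
          have := hcon {k} (hSing k)
          simpa using this
      refine Set.infinite_univ (h2.subset ?_)
      intro n _
      exact Set.mem_biUnion (Set.mem_range_self n) rfl
  obtain ⟨B, hBI, hS⟩ := hB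
  have hG : ∀ n, ((x '' {n | f (x n) ∈ B}) ∩ F n).Infinite := by
    intro n
    have h1 : ({n | f (x n) ∈ B} \ Set.Iio n).Infinite := hS.diff (Set.finite_Iio n)
    refine (h1.image hinj.injOn).mono ?_
    rintro _ ⟨m, ⟨hm, hmn⟩, rfl⟩
    exact ⟨⟨m, hm, rfl⟩, hanti (not_lt.mp hmn) (hx1 m)⟩
  refine ⟨x '' {n | f (x n) ∈ B}, hI.2.1 _ B ?_ hBI, hG, ?_⟩
  · rintro _ ⟨_, ⟨m, hm, rfl⟩, rfl⟩
    exact hm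
  · intro H hH
    have key : ∀ A : Set ℕ, ∃ N, A ∈ H → (x '' {n | f (x n) ∈ B}) ∩ F N ⊆ A := by
      intro A
      by_cases hA : A ∈ H
      · rcases hH hA with ⟨N, rfl⟩ | h
        · exact ⟨N, fun _ => Set.inter_subset_right⟩
        · exact ⟨0, fun _ => by rw [Set.mem_singleton_iff.mp h]; exact Set.inter_subset_left⟩
      · exact ⟨0, fun h => absurd h hA⟩
    choose N hN using key
    obtain ⟨a, ha1, ha2⟩ := (hG (H.sup N)).nonempty
    exact ⟨a, fun A hA => hN A hA ⟨ha1, hanti (Finset.le_sup (f := N) hA) ha2⟩⟩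
end

section
/- Let (A_n)_{n∈ℕ} be a sequence of pairwise disjoint infinite subsets of ℕ and let F be a countable family of subsets of ℕ with the finite intersection property. Then there exists a set B ⊆ ℕ whose complement ℕ \ B belongs to the rank-2 contour C((A_n)) and such that F ∪ {B} has the finite intersection property. In particular, no filter on ℕ generated by a countable family contains C((A_n)). -/
open Filter Set

/-- for any countable family F with the finite intersection property
there is a set B residual for the rank-2 contour such that F ∪ {B} still has the
finite intersection property; in particular the filter generated by F does not
contain the rank-2 contour. -/
theorem exists_residual_set_fip
    (A : ℕ → Set ℕ) (hdisj : ∀ m n : ℕ, m ≠ n → Disjoint (A m) (A n))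
    (hinf : ∀ n, (A n).Infinite)
    (F : Set (Set ℕ)) (hFc : F.Countable) (hFIP : HasFIP F) :
    (∃ B : Set ℕ, Bᶜ ∈ rank2Contour A ∧ HasFIP (F ∪ {B})) ∧
      ¬ (∀ V ∈ rank2Contour A, V ∈ Filter.generate F) := by
  have hne : (Filter.generate F).NeBot := by
    rw [Filter.generate_neBot_iff]
    intro t ht htf
    have := hFIP htf.toFinset (by simpa using ht)
    simpa using this
  have hcg : (Filter.generate F).IsCountablyGenerated := ⟨⟨F, hFc, rfl⟩⟩
  have key : ∃ B : Set ℕ, Bᶜ ∈ rank2Contour A ∧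
      ∀ U ∈ Filter.generate F, (U ∩ B).Nonempty := by
    obtain ⟨S, hS⟩ := (Filter.generate F).exists_antitone_basis
    by_cases h : ∃ k N, S k ⊆ ⋃ i ∈ Set.Iio N, A i
    · obtain ⟨k, N, hk⟩ := h
      refine ⟨S k, ?_, fun U hU => Filter.nonempty_of_mem (Filter.inter_mem hU (hS.mem k))⟩
      have : ∀ᶠ n in Filter.cofinite, (A n \ (S k)ᶜ).Finite := by
        rw [Nat.cofinite_eq_atTop]
        filter_upwards [Filter.eventually_ge_atTop N] with n hn
        convert Set.finite_empty
        ext x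
        simp only [Set.mem_diff, Set.mem_compl_iff, not_not, Set.mem_empty_iff_false, iff_false]
        rintro ⟨hx, hxS⟩
        have := hk hxS
        simp only [Set.mem_iUnion, Set.mem_Iio] at this
        obtain ⟨i, hi, hxi⟩ := this
        exact Set.disjoint_left.1 (hdisj i n (by omega)) hxi hx
      exact this
    · push Not at h
      have h2 : ∀ k, ∃ x ∈ S k, x ∉ ⋃ i ∈ Set.Iio k, A i :=
        fun k => Set.not_subset.1 (h k k)
      choose x hxS hxA using h2
      refine ⟨Set.range x, ?_, fun U hU => ?_⟩
      · have : ∀ᶠ n in Filter.cofinite, (A n \ (Set.range x)ᶜ).Finite := by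
          refine Filter.Eventually.of_forall fun n => ?_
          refine ((Set.finite_Iic n).image x).subset ?_
          rintro y ⟨hy, hy2⟩
          simp only [Set.mem_compl_iff, not_not] at hy2
          obtain ⟨k, rfl⟩ := hy2
          refine ⟨k, ?_, rfl⟩
          by_contra hc
          simp only [Set.mem_Iic, not_le] at hc
          exact hxA k (Set.mem_biUnion (Set.mem_Iio.2 hc) hy)
        exact this
      · obtain ⟨k, -, hk⟩ := hS.1.mem_iff.1 hU
        exact ⟨x k, hk (hxS k), k, rfl⟩
  obtain ⟨B, hB, hBU⟩ := key
  refine ⟨⟨B, hB, fun G hG => ?_⟩, fun hall => ?_⟩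
  · have hm : ⋂₀ ((G : Set (Set ℕ)) \ {B}) ∈ Filter.generate F := by
      rw [Filter.sInter_mem (G.finite_toSet.subset Set.diff_subset)]
      rintro U ⟨hU, hUB⟩
      rcases hG hU with h | h
      · exact Filter.mem_generate_of_mem h
      · exact absurd h hUB
    obtain ⟨y, hy, hyB⟩ := hBU _ hm
    refine ⟨y, fun U hU => ?_⟩
    by_cases hUB : U = B
    · exact hUB ▸ hyB
    · exact hy U ⟨hU, hUB⟩
  · obtain ⟨y, hy, hyB⟩ := hBU _ (hall _ hB)
    exact hy hyB
end
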